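/- arXiv:1801.01231 — 5 statements merged into one kernel-verified Lean document; each statement's English description precedes it below -/
import Mathlib

section
/- Universality of the fermionic ZW calculus: every pure linear map Q^{⊗n} → Q^{⊗m} belongs to the family 𝒞 generated by the identity, the tensor symmetry, the fermionic swap, the cup, the cap, the binary and ternary black states, and the binary white states, under composition and tensor product. -/
/-- Bitstrings of length `n`, indexing the standard basis of `Q^{⊗n}` where `Q = ℂ²`. -/
abbrev BStr (n : ℕ) : Type := Fin n → Bool

/-- Vectors of `Q^{⊗n}`, given by their coordinates over the bitstring basis. -/
abbrev Vec (n : ℕ) : Type := BStr n → ℂ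

/-- Linear maps `Q^{⊗n} → Q^{⊗m}`, represented as matrices indexed by bitstrings;
composition is matrix multiplication and tensor product is the Kronecker product. -/
abbrev QMap (n m : ℕ) : Type := Matrix (BStr m) (BStr n) ℂ

noncomputable section

/-- Kronecker (tensor) product of maps, under the identification
`Q^{⊗n} ⊗ Q^{⊗p} ≅ Q^{⊗(n+p)}`. -/
def tensM {n m p q : ℕ} (A : QMap n m) (B : QMap p q) : QMap (n + p) (m + q) :=
  Matrix.of fun b a =>
    A (fun i => b (Fin.castAdd q i)) (fun i => a (Fin.castAdd p i)) *
      B (fun j => b (Fin.natAdd m j)) (fun j => a (Fin.natAdd n j))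

/-- Recasting a map along equalities of the numbers of wires (the canonical
identification of tensor powers). -/
def castM {n m n' m' : ℕ} (hn : n = n') (hm : m = m') (A : QMap n m) : QMap n' m' :=
  Matrix.of fun b a => A (fun i => b (Fin.cast hm i)) (fun i => a (Fin.cast hn i))

/-- `|a|`: the number of 1s in a bitstring. -/
def wt {n : ℕ} (a : BStr n) : ℕ := (Finset.univ.filter fun i => a i = true).card

/-- Standard basis vector `e_a`. -/
def basisV {n : ℕ} (a : BStr n) : Vec n := fun b => if b = a then 1 else 0

/-- Tensor product of vectors. -/
def tensVec {n m : ℕ} (v : Vec n) (w : Vec m) : Vec (n + m) :=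
  fun a => v (fun i => a (Fin.castAdd m i)) * w (fun j => a (Fin.natAdd n j))

/-- Identity on one wire. -/
def idQ : QMap 1 1 := 1

/-- Identity on `n` wires. -/
def idN (n : ℕ) : QMap n n := 1

/-- Tensor symmetry `σ : v ⊗ w ↦ w ⊗ v`. -/
def sigmaM : QMap 2 2 :=
  Matrix.of fun b a => if b 0 = a 1 ∧ b 1 = a 0 then 1 else 0

/-- The fermionic swap `F : e_a ⊗ e_b ↦ (−1)^{ab} e_b ⊗ e_a`. -/
def FM : QMap 2 2 :=
  Matrix.of fun b a =>
    if b 0 = a 1 ∧ b 1 = a 0 then (if a 0 && a 1 then -1 else 1) else 0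

/-- The cup `η : 1 ↦ e₀⊗e₀ + e₁⊗e₁`. -/
def cupM : QMap 0 2 := Matrix.of fun b _ => if b 0 = b 1 then 1 else 0

/-- The cap `c : e_a ⊗ e_b ↦ δ_{ab}`. -/
def capM : QMap 2 0 := Matrix.of fun _ a => if a 0 = a 1 then 1 else 0

/-- Binary black vertex state `1 ↦ e₁⊗e₀ + e₀⊗e₁`. -/
def black2S : QMap 0 2 := Matrix.of fun b _ => if b 0 ≠ b 1 then 1 else 0

/-- Ternary black vertex state `1 ↦ e₁⊗e₀⊗e₀ + e₀⊗e₁⊗e₀ + e₀⊗e₀⊗e₁`. -/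
def black3S : QMap 0 3 := Matrix.of fun b _ => if wt b = 1 then 1 else 0

/-- Binary white vertex state `1 ↦ e₀⊗e₀ + z·e₁⊗e₁`. -/
def whiteS (z : ℂ) : QMap 0 2 :=
  Matrix.of fun b _ =>
    if b 0 = false ∧ b 1 = false then 1 else if b 0 = true ∧ b 1 = true then z else 0

/-- The white vertex `W_z : e₀ ↦ e₀, e₁ ↦ z·e₁`. -/
def Wmap (z : ℂ) : QMap 1 1 :=
  Matrix.of fun b a => if b = a then (if a 0 then z else 1) else 0

/-- The Pauli `Z` gate: `e₀ ↦ e₀, e₁ ↦ −e₁`. -/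
def Zm : QMap 1 1 :=
  Matrix.of fun b a => if b = a then (if a 0 then -1 else 1) else 0

/-- The Pauli `X` gate: `e₀ ↦ e₁, e₁ ↦ e₀`. -/
def Xm : QMap 1 1 := Matrix.of fun b a => if b 0 = a 0 then 0 else 1

/-- The fermionic line multiplication `m`. -/
def mMul : QMap 2 1 :=
  Matrix.of fun b a =>
    match a 0, a 1, b 0 with
    | false, false, false => 1
    | true, false, true => 1
    | false, true, true => 1
    | _, _, _ => 0

/-- The fermionic line unit `u : 1 ↦ e₀`. -/
def uM : QMap 0 1 := Matrix.of fun b _ => if b 0 = false then 1 else 0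

/-- The fermionic line comultiplication `Δ`. -/
def deltaM : QMap 1 2 :=
  Matrix.of fun b a =>
    match a 0, b 0, b 1 with
    | false, false, false => 1
    | true, true, false => 1
    | true, false, true => 1
    | _, _, _ => 0

/-- The fermionic line counit `ε : e₀ ↦ 1, e₁ ↦ 0`. -/
def epsM : QMap 1 0 := Matrix.of fun _ a => if a 0 = false then 1 else 0

/-- The even projector `P` on two wires. -/
def Pm : QMap 2 2 := Matrix.of fun b a => if b = a ∧ a 0 = a 1 then 1 else 0

/-- The beam splitter `BS(r,t)`. -/
def BS (r t : ℂ) : QMap 2 2 :=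
  Matrix.of fun b a =>
    match a 0, a 1, b 0, b 1 with
    | false, false, false, false => 1
    | true, false, true, false => r
    | true, false, false, true => t
    | false, true, true, false => -((starRingEnd ℂ) t)
    | false, true, false, true => (starRingEnd ℂ) r
    | true, true, true, true => 1
    | _, _, _, _ => 0

/-- The black spider `B_{n,m}`: matrix entry at `(b,a)` is 1 if `|a|+|b| = 1` and 0
otherwise. -/
def bspider (n m : ℕ) : QMap n m :=
  Matrix.of fun b a => if wt a + wt b = 1 then 1 else 0

/-- The white spider `V^z_{n,m}`: entry 1 at the all-0 corner and `z` at the all-1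
corner, 0 elsewhere. -/
def wspider (z : ℂ) (n m : ℕ) : QMap n m :=
  Matrix.of fun b a =>
    (if (∀ i, a i = false) ∧ (∀ j, b j = false) then 1 else 0) +
      (if (∀ i, a i = true) ∧ (∀ j, b j = true) then z else 0)

/-- Entry of a binary white vertex, as a `Bool`-indexed matrix. -/
def Wentry (z : ℂ) (b a : Bool) : ℂ := if b = a then (if a then z else 1) else 0

/-- `n`-fold Kronecker product `W_{z₁} ⊗ ⋯ ⊗ W_{zₙ}` of white vertices. -/
def whites {n : ℕ} (z : Fin n → ℂ) : QMap n n :=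
  Matrix.of fun b a => ∏ i, Wentry (z i) (b i) (a i)

/-- The bitstring of length `n` with a single 1 in position `k`. -/
def deltaStr {n : ℕ} (k : Fin n) : BStr n := fun i => decide (i = k)

/-- The black spider state `b_n = Σ_{k<n} e_{δ_k}`. -/
def bvec (n : ℕ) : Vec n := ∑ k : Fin n, basisV (deltaStr k)

/-- The white spider state `G_{n,z} = e_{0…0} + z·e_{1…1}`. -/
def Gvec (n : ℕ) (z : ℂ) : Vec n :=
  basisV (fun _ => false) + z • basisV (fun _ => true)

/-- The even subspace of `Q^{⊗n}`: span of the `e_a` with `|a|` even. -/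
def evenSub (n : ℕ) : Submodule ℂ (Vec n) :=
  Submodule.span ℂ {v | ∃ a : BStr n, Even (wt a) ∧ v = basisV a}

/-- The odd subspace of `Q^{⊗n}`: span of the `e_a` with `|a|` odd. -/
def oddSub (n : ℕ) : Submodule ℂ (Vec n) :=
  Submodule.span ℂ {v | ∃ a : BStr n, Odd (wt a) ∧ v = basisV a}

/-- A map is even if it preserves the parity grading. -/
def IsEvenMap {n m : ℕ} (A : QMap n m) : Prop :=
  (∀ v ∈ evenSub n, A.mulVec v ∈ evenSub m) ∧ ∀ v ∈ oddSub n, A.mulVec v ∈ oddSub m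

/-- A map is odd if it reverses the parity grading. -/
def IsOddMap {n m : ℕ} (A : QMap n m) : Prop :=
  (∀ v ∈ evenSub n, A.mulVec v ∈ oddSub m) ∧ ∀ v ∈ oddSub n, A.mulVec v ∈ evenSub m

/-- A map is pure if it is even or odd. -/
def IsPure {n m : ℕ} (A : QMap n m) : Prop := IsEvenMap A ∨ IsOddMap A

/-- The family `𝒞` generated by the identity, the tensor symmetry, the fermionic
swap, the cup, the cap, the binary and ternary black states and the binary white
states, under composition and tensor product. -/
inductive Gen : ∀ {n m : ℕ}, QMap n m → Prop where
  | wire : Gen idQ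
  | swap : Gen sigmaM
  | fswap : Gen FM
  | cup : Gen cupM
  | cap : Gen capM
  | black2 : Gen black2S
  | black3 : Gen black3S
  | white (z : ℂ) : Gen (whiteS z)
  | comp {n m k : ℕ} {A : QMap n m} {B : QMap m k} : Gen A → Gen B → Gen (B * A)
  | prod {n m p q : ℕ} {A : QMap n m} {B : QMap p q} : Gen A → Gen B → Gen (tensM A B)

/-! ### Concatenation of bitstrings -/

/-- The bitstring of length one. -/
def bit (p : Bool) : BStr 1 := fun _ => p

/-- The bitstring of length two. -/
def bits (p q : Bool) : BStr 2 := ![p, q]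

@[simp] lemma bit_apply (p : Bool) (i : Fin 1) : bit p i = p := rfl

@[simp] lemma bits_zero (p q : Bool) : bits p q 0 = p := rfl

@[simp] lemma bits_one (p q : Bool) : bits p q 1 = q := rfl

lemma exists_append {n k : ℕ} (x : BStr (n + k)) :
    ∃ (y : BStr n) (z : BStr k), x = Fin.append y z :=
  ⟨fun i => x (Fin.castAdd k i), fun j => x (Fin.natAdd n j), (Fin.append_castAdd_natAdd).symm⟩

lemma exists_bit (x : BStr 1) : ∃ p, x = (bit p) :=
  ⟨x 0, by ext i; fin_cases i; rfl⟩

lemma exists_two_bits (x : BStr 2) : ∃ p q, x = (bits p q) :=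
  ⟨x 0, x 1, by ext i; fin_cases i <;> rfl⟩

lemma append_append_bit {n : ℕ} (x : BStr n) (p q : Bool) :
    Fin.append (m := n + 1) (n := 1) (Fin.append x (bit p)) (bit q) =
      Fin.append (m := n) (n := 2) x (bits p q) := by
  ext i
  refine Fin.addCases (m := n) (n := 2) (fun j => ?_) (fun j => ?_) i
  · rw [Fin.append_left]
    exact (Fin.append_left (Fin.append x (bit p)) (bit q) (Fin.castAdd 1 j)).trans
      (Fin.append_left x (bit p) j)
  · rw [Fin.append_right]
    fin_cases j
    · exact (Fin.append_left (Fin.append x (bit p)) (bit q) (Fin.natAdd n 0)).trans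
        (Fin.append_right x (bit p) 0)
    · exact Fin.append_right (Fin.append x (bit p)) (bit q) 0

lemma append_empty {n : ℕ} (x : BStr n) (y : BStr 0) : (Fin.append x y : BStr n) = x := by
  ext i
  exact Fin.append_left x y i

lemma append_inj_iff {n k : ℕ} (x y : BStr n) (z w : BStr k) :
    Fin.append x z = Fin.append y w ↔ x = y ∧ z = w := by
  refine ⟨fun h => ⟨?_, ?_⟩, fun h => by rw [h.1, h.2]⟩
  · ext i
    simpa using congrFun h (Fin.castAdd k i)
  · ext i
    simpa using congrFun h (Fin.natAdd n i)

lemma bit_inj (p q : Bool) : ((bit p) : BStr 1) = (bit q) ↔ p = q :=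
  ⟨fun h => congrFun h 0, fun h => by rw [h]⟩

lemma two_bits_inj (p q r s : Bool) : ((bits p q) : BStr 2) = (bits r s) ↔ p = r ∧ q = s :=
  ⟨fun h => ⟨congrFun h 0, congrFun h 1⟩, fun h => by rw [h.1, h.2]⟩

lemma sum_append {n k : ℕ} (f : BStr (n + k) → ℂ) :
    ∑ x, f x = ∑ y : BStr n, ∑ z : BStr k, f (Fin.append y z) := by
  rw [← (Fin.appendEquiv n k).sum_comp, Fintype.sum_prod_type]
  rfl

lemma sum_bit (f : BStr 1 → ℂ) : ∑ x, f x = ∑ p : Bool, f (bit p) := by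
  rw [← (Equiv.funUnique (Fin 1) Bool).symm.sum_comp]
  refine Finset.sum_congr rfl fun p _ => congrArg f ?_
  ext i; fin_cases i; rfl

lemma sum_two_bits (f : BStr 2 → ℂ) : ∑ x, f x = ∑ p : Bool, ∑ q : Bool, f (bits p q) := by
  rw [← (finTwoArrowEquiv Bool).symm.sum_comp, Fintype.sum_prod_type]
  rfl

lemma wt_append {n k : ℕ} (x : BStr n) (y : BStr k) : wt (Fin.append x y) = wt x + wt y := by
  simp only [wt, Finset.card_filter, Fin.sum_univ_add, Fin.append_left, Fin.append_right]

lemma wt_bit (p : Bool) : wt (bit p) = if p then 1 else 0 := by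
  revert p; decide

lemma wt_two_bits (p q : Bool) :
    wt (bits p q) = (if p then 1 else 0) + (if q then 1 else 0) := by
  revert p q; decide

/-! ### Composition with maps acting on the last wires -/

lemma tensM_append {n m p q : ℕ} (A : QMap n m) (B : QMap p q) (b : BStr m) (b' : BStr q)
    (a : BStr n) (a' : BStr p) :
    tensM A B (Fin.append b b') (Fin.append a a') = A b a * B b' a' := by
  simp [tensM]

lemma tensM_idN_mul {n p q r : ℕ} (B : QMap p q) (M : QMap r (n + p)) (b : BStr n)
    (b' : BStr q) (a : BStr r) :
    (tensM (idN n) B * M) (Fin.append b b') a = ∑ z, B b' z * M (Fin.append b z) a := by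
  rw [Matrix.mul_apply, sum_append]
  simp only [tensM_append, idN, Matrix.one_apply, ite_mul, one_mul, zero_mul]
  rw [Finset.sum_eq_single b] <;> simp +contextual [eq_comm]

lemma mul_tensM_idN {n p q r : ℕ} (B : QMap p q) (M : QMap (n + q) r) (c : BStr r)
    (a : BStr n) (a' : BStr p) :
    (M * tensM (idN n) B) c (Fin.append a a') = ∑ z, M c (Fin.append a z) * B z a' := by
  rw [Matrix.mul_apply, sum_append]
  simp only [tensM_append, idN, Matrix.one_apply, ite_mul, one_mul, zero_mul]
  rw [Finset.sum_eq_single a] <;> simp +contextual [eq_comm]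

lemma tensM_mul_idQ {n m r : ℕ} (A : QMap n m) (M : QMap r (n + 1)) (b : BStr m) (p : Bool)
    (a : BStr r) :
    (tensM A idQ * M) (Fin.append b (bit p)) a = ∑ z, A b z * M (Fin.append z (bit p)) a := by
  rw [Matrix.mul_apply, sum_append]
  simp only [tensM_append, idQ, Matrix.one_apply, mul_ite, mul_one, mul_zero]
  refine Finset.sum_congr rfl fun z _ => ?_
  rw [Finset.sum_eq_single (bit p)] <;> simp +contextual [eq_comm]

lemma tensM_bit {n m : ℕ} (A : QMap n m) (b : BStr m) (p : Bool) (a : BStr n) (r : Bool) :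
    (tensM A idQ : QMap (n + 1) (m + 1)) (Fin.append b (bit p)) (Fin.append a (bit r)) =
      if p = r then A b a else 0 := by
  rw [tensM_append]
  simp [idQ, Matrix.one_apply, bit_inj]

lemma Gen.congr {n m : ℕ} {A B : QMap n m} (hA : Gen A) (h : B = A) : Gen B := h ▸ hA

lemma gen_idN (n : ℕ) : Gen (idN n) := by
  induction n with
  | zero =>
    convert Gen.comp (Gen.white 0) Gen.cap
    ext b a
    simp [idN, Matrix.mul_apply, sum_two_bits, capM, whiteS, Matrix.one_apply,
      Subsingleton.elim b a]
  | succ n ih =>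
    convert Gen.prod ih Gen.wire
    ext b a
    obtain ⟨b, b', rfl⟩ := exists_append b
    obtain ⟨a, a', rfl⟩ := exists_append a
    rw [tensM_append]
    simp only [idN, idQ, Matrix.one_apply, append_inj_iff, ite_and]
    split_ifs <;> simp

lemma wt_zero (x : BStr 0) : wt x = 0 := by
  simp [wt]

/-! ### Wire bending and generated elementary maps -/

/-- The last output of a map turned into a last input. -/
def bend {n m : ℕ} (A : QMap n (m + 1)) : QMap (n + 1) m :=
  Matrix.of fun b a => A (Fin.append b fun _ => a (Fin.last n)) fun i => a i.castSucc

lemma bend_append {n m : ℕ} (A : QMap n (m + 1)) (b : BStr m) (a : BStr n) (p : Bool) :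
    bend A b (Fin.append a (bit p)) = A (Fin.append b (bit p)) a := by
  have h1 : (fun i : Fin n => Fin.append a (bit p) i.castSucc) = a := by
    ext i
    exact Fin.append_left a (bit p) i
  have h2 : (fun _ => Fin.append a (bit p) (Fin.last n)) = bit p := by
    ext i
    exact Fin.append_right a (bit p) 0
  rw [bend, Matrix.of_apply, h1, h2]

lemma Gen.bend {n m : ℕ} {A : QMap n (m + 1)} (hA : Gen A) : Gen (bend A) := by
  have h : Gen ((tensM (idN m) capM : QMap (m + 2) m) * (tensM (m := m + 1) A idQ : QMap (n + 1) (m + 2))) :=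
    Gen.comp (Gen.prod hA Gen.wire) (Gen.prod (gen_idN m) Gen.cap)
  refine h.congr ?_
  ext b a
  obtain ⟨a, a', rfl⟩ := exists_append a
  obtain ⟨p, rfl⟩ := exists_bit a'
  rw [bend_append, ← append_empty b Fin.elim0]
  refine Eq.trans ?_ (tensM_idN_mul capM (tensM (m := m + 1) A idQ : QMap (n + 1) (m + 2)) b _ _).symm
  simp only [sum_two_bits, ← append_append_bit, append_empty]
  cases p <;> simp [tensM_bit, capM]

lemma bend_bspider (n m : ℕ) : bend (bspider n (m + 1)) = bspider (n + 1) m := by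
  ext b a
  obtain ⟨a, a', rfl⟩ := exists_append a
  obtain ⟨p, rfl⟩ := exists_bit a'
  rw [bend_append]
  simp only [bspider, Matrix.of_apply, wt_append]
  congr 2
  lia

lemma gen_bspider_zero_three : Gen (bspider 0 3) := by
  refine Gen.black3.congr ?_
  ext b a
  simp only [bspider, black3S, Matrix.of_apply, wt_zero, zero_add]

lemma gen_bspider_one_two : Gen (bspider 1 2) :=
  (bend_bspider 0 2) ▸ gen_bspider_zero_three.bend

lemma gen_bspider_two_one : Gen (bspider 2 1) :=
  (bend_bspider 1 1) ▸ gen_bspider_one_two.bend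

lemma bit_append_bit {p q : Bool} :
    (Fin.append (bit p) (bit q) : BStr 2) = bits p q := by
  ext i; fin_cases i <;> rfl

lemma bend_bit {m : ℕ} (A : QMap 0 (m + 1)) (b : BStr m) (p : Bool) :
    bend A b (bit p) = A (Fin.append b (bit p)) Fin.elim0 := by
  rw [bend, Matrix.of_apply, Subsingleton.elim (fun i : Fin 0 => bit p i.castSucc) Fin.elim0]
  rfl

lemma gen_Xm : Gen Xm := by
  refine (Gen.bend (n := 0) (m := 1) Gen.black2).congr ?_
  ext b a
  obtain ⟨p, rfl⟩ := exists_bit b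
  obtain ⟨q, rfl⟩ := exists_bit a
  rw [bend_bit, bit_append_bit]
  cases p <;> cases q <;> simp [Xm, black2S]

lemma gen_Wmap (z : ℂ) : Gen (Wmap z) := by
  refine (Gen.bend (n := 0) (m := 1) (Gen.white z)).congr ?_
  ext b a
  obtain ⟨p, rfl⟩ := exists_bit b
  obtain ⟨q, rfl⟩ := exists_bit a
  rw [bend_bit, bit_append_bit]
  cases p <;> cases q <;> simp [Wmap, whiteS, bit_inj]

lemma gen_bspider_zero_one : Gen (bspider 0 1) := by
  refine Gen.congr (gen_bspider_zero_three.comp ((gen_idN 1).prod Gen.cap)) ?_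
  ext b a
  rw [← append_empty b Fin.elim0]
  refine Eq.trans ?_ (tensM_idN_mul capM (bspider 0 3) b _ _).symm
  obtain ⟨p, rfl⟩ := exists_bit b
  cases p <;> simp [sum_two_bits, capM, bspider, wt_append, wt_bit, wt_two_bits, wt_zero]

/-! ### Parity states -/

/-- The map splitting a wire into two whose total parity is that of the wire. -/
def splitM : QMap 1 2 :=
  Matrix.of fun b a => if (b 0 ^^ b 1) = a 0 then 1 else 0

lemma gen_splitM : Gen splitM := by
  have h := ((gen_Xm.comp gen_bspider_one_two).comp
    (gen_bspider_one_two.prod Gen.wire)).comp ((gen_idN 1).prod gen_bspider_two_one)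
  refine h.congr ?_
  ext b a
  obtain ⟨p, q, rfl⟩ := exists_two_bits b
  obtain ⟨r, rfl⟩ := exists_bit a
  rw [← bit_append_bit]
  refine Eq.trans ?_ (tensM_idN_mul (bspider 2 1) _ _ _ _).symm
  simp only [sum_two_bits, ← append_append_bit, bit_append_bit]
  simp only [tensM_mul_idQ (bspider 1 2) (bspider 1 2 * Xm)]
  cases p <;> cases q <;> cases r <;>
    simp [sum_bit, bit_append_bit, splitM, bspider, Matrix.mul_apply, Xm, wt_bit, wt_two_bits]

lemma even_wt_append_bits {n : ℕ} (x : BStr n) (p q : Bool) :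
    Even (wt (Fin.append x (bits p q))) ↔ Even (wt (Fin.append x (bit (p ^^ q)))) := by
  simp only [wt_append, wt_two_bits, wt_bit]
  cases p <;> cases q <;> simp [Nat.even_add, parity_simps]

lemma gen_scalar (z : ℂ) : Gen (Matrix.of fun _ _ => z : QMap 0 0) := by
  convert Gen.comp (Gen.white (z - 1)) Gen.cap
  ext b a
  simp [Matrix.mul_apply, sum_two_bits, capM, whiteS]

/-- The sum of all basis states of a given parity. -/
def parityS (e : Prop) [Decidable e] (n : ℕ) : QMap 0 n :=
  Matrix.of fun b _ => if (Even (wt b) ↔ e) then 1 else 0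

lemma gen_parityS (e : Prop) [Decidable e] (n : ℕ) : Gen (parityS e n) := by
  induction n using Nat.strong_induction_on with
  | _ n ih =>
  match n with
  | 0 =>
    convert gen_scalar (if e then 1 else 0)
    ext b a
    simp [parityS, wt]
  | 1 =>
    by_cases he : e
    · refine Gen.congr (gen_bspider_zero_one.comp gen_Xm) ?_
      ext b a
      obtain ⟨p, rfl⟩ := exists_bit b
      cases p <;> simp [Matrix.mul_apply, sum_bit, parityS, Xm, bspider, wt_bit, wt_zero, he]
    · refine Gen.congr gen_bspider_zero_one ?_
      ext b a
      obtain ⟨p, rfl⟩ := exists_bit b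
      cases p <;> simp [parityS, bspider, wt_bit, wt_zero, he]
  | n + 2 =>
    have h := (ih (n + 1) (by lia)).comp ((gen_idN n).prod gen_splitM : Gen (n := n + 1) (m := n + 2) _)
    refine h.congr ?_
    ext b a
    obtain ⟨b, b', rfl⟩ := exists_append b
    obtain ⟨p, q, rfl⟩ := exists_two_bits b'
    refine Eq.trans ?_ (tensM_idN_mul splitM (parityS e (n + 1)) b _ _).symm
    rw [sum_bit]
    cases p <;> cases q <;> simp [parityS, even_wt_append_bits, splitM]

/-! ### Diagonal maps -/

/-- The diagonal map with the given diagonal is generated. -/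
def GenDiag {n : ℕ} (f : BStr n → ℂ) : Prop := Gen (Matrix.diagonal f : QMap n n)

lemma GenDiag.mul {n : ℕ} {f g : BStr n → ℂ} (hf : GenDiag f) (hg : GenDiag g) :
    GenDiag fun x => f x * g x :=
  (Gen.comp hg hf).congr (Matrix.diagonal_mul_diagonal f g).symm

lemma GenDiag.tensVec {n m : ℕ} {f : BStr n → ℂ} {g : BStr m → ℂ} (hf : GenDiag f)
    (hg : GenDiag g) : GenDiag (tensVec f g) := by
  refine (Gen.prod hf hg).congr ?_
  ext b a
  obtain ⟨b, b', rfl⟩ := exists_append b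
  obtain ⟨a, a', rfl⟩ := exists_append a
  rw [tensM_append]
  simp only [Matrix.diagonal_apply, append_inj_iff, _root_.tensVec, Fin.append_left,
    Fin.append_right]
  split_ifs <;> simp_all

lemma genDiag_one (n : ℕ) : GenDiag fun _ : BStr n => 1 :=
  (gen_idN n).congr Matrix.diagonal_one

/-- Conjugation by a bit-permuting map on the last wires. -/
lemma GenDiag.conj {n k : ℕ} {f : BStr (n + k) → ℂ} (hf : GenDiag f) {B : QMap k k}
    (hB : Gen B) (e : BStr k → BStr k) (he : Function.Involutive e)
    (h : ∀ b a, B b a = if b = e a then 1 else 0) {g : BStr (n + k) → ℂ}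
    (hg : ∀ x y, g (Fin.append x y) = f (Fin.append x (e y))) : GenDiag g := by
  have hT := (gen_idN n).prod hB
  refine ((hT.comp hf).comp hT).congr ?_
  ext b a
  obtain ⟨b, b', rfl⟩ := exists_append b
  obtain ⟨a, a', rfl⟩ := exists_append a
  rw [tensM_idN_mul]
  simp only [mul_tensM_idN, h, Matrix.diagonal_apply, append_inj_iff, hg]
  have hz : ∀ z, (b' = e z) = (z = e b') := fun z => propext
    ⟨fun h => by rw [h, he z], fun h => by rw [h, he b']⟩
  simp only [hz, ite_mul, one_mul, zero_mul, mul_ite, mul_one, mul_zero, Finset.sum_ite_eq',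
    Finset.mem_univ, if_true]
  rw [Finset.sum_eq_single (e b') (fun z _ hz => by simp [hz]) (by simp)]
  simp [he.injective.eq_iff]

/-- Summation over the last variable. -/
lemma GenDiag.trace {n : ℕ} {f : BStr (n + 1) → ℂ} (hf : GenDiag f) :
    GenDiag fun x : BStr n => ∑ p, f (Fin.append x (bit p)) := by
  have h := (((gen_idN n).prod Gen.cup : Gen (n := n) (m := n + 2) _).comp
    (Gen.prod (A := Matrix.diagonal f) hf Gen.wire : Gen (n := n + 2) (m := n + 2) _)).comp
    ((gen_idN n).prod Gen.cap : Gen (n := n + 2) (m := n) _)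
  refine h.congr ?_
  ext b a
  rw [← append_empty b Fin.elim0, ← append_empty a Fin.elim0]
  refine Eq.trans ?_ (tensM_idN_mul capM _ b _ _).symm
  have h2 := fun z : BStr 2 => mul_tensM_idN cupM
    (tensM (n := n + 1) (m := n + 1) (Matrix.diagonal f) idQ : QMap (n + 2) (n + 2))
    (Fin.append (m := n) (n := 2) b z) a Fin.elim0
  refine Eq.trans ?_ (Finset.sum_congr rfl fun z _ => congrArg (capM Fin.elim0 z * ·) (h2 z).symm)
  simp only [sum_two_bits, ← append_append_bit, tensM_bit, append_empty]
  simp [capM, cupM, Matrix.diagonal_apply, append_inj_iff]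
  split_ifs <;> simp

lemma GenDiag.flip {n : ℕ} {f g : BStr (n + 1) → ℂ} (hf : GenDiag f)
    (hg : ∀ x p, g (Fin.append x (bit p)) = f (Fin.append x (bit !p))) : GenDiag g := by
  refine hf.conj gen_Xm (fun x => bit !(x 0)) (fun x => ?_) (fun b a => ?_) fun x y => ?_
  · obtain ⟨p, rfl⟩ := exists_bit x
    simp
  · obtain ⟨p, rfl⟩ := exists_bit b
    obtain ⟨q, rfl⟩ := exists_bit a
    cases p <;> cases q <;> simp [Xm, bit_inj]
  · obtain ⟨p, rfl⟩ := exists_bit y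
    exact hg x p

lemma GenDiag.swap {n : ℕ} {f g : BStr (n + 2) → ℂ} (hf : GenDiag f)
    (hg : ∀ x p q, g (Fin.append x (bits p q)) = f (Fin.append x (bits q p))) : GenDiag g := by
  refine hf.conj Gen.swap (fun x => bits (x 1) (x 0)) (fun x => ?_) (fun b a => ?_) fun x y => ?_
  · obtain ⟨p, q, rfl⟩ := exists_two_bits x
    simp
  · obtain ⟨p, q, rfl⟩ := exists_two_bits b
    obtain ⟨r, s, rfl⟩ := exists_two_bits a
    simp only [sigmaM, two_bits_inj, Matrix.of_apply, bits_zero, bits_one]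
    congr
  · obtain ⟨p, q, rfl⟩ := exists_two_bits y
    exact hg x p q

lemma GenDiag.extend {n : ℕ} {f : BStr n → ℂ} (hf : GenDiag f) (k : ℕ) :
    GenDiag fun x : BStr (n + k) => f fun i => x (Fin.castAdd k i) := by
  convert hf.tensVec (genDiag_one k) with x
  simp [_root_.tensVec]

lemma GenDiag.extend_left {k : ℕ} {f : BStr k → ℂ} (hf : GenDiag f) (n : ℕ) :
    GenDiag fun x : BStr (n + k) => f fun i => x (Fin.natAdd n i) := by
  convert (genDiag_one n).tensVec hf with x
  simp [_root_.tensVec]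

lemma genDiag_bit (u : Bool → ℂ) : GenDiag fun x : BStr 1 => u (x 0) := by
  have h (z : ℂ) : GenDiag fun x : BStr 1 => if x 0 then z else 1 := by
    refine (gen_Wmap z).congr ?_
    ext b a
    obtain ⟨p, rfl⟩ := exists_bit b
    obtain ⟨q, rfl⟩ := exists_bit a
    simp only [Matrix.diagonal_apply, Wmap, Matrix.of_apply, bit_inj, bit_apply]
    split_ifs <;> simp_all
  have h' : GenDiag fun x : BStr 1 => if x 0 then 1 else u false := by
    refine GenDiag.flip (n := 0) (h (u false)) fun x p => ?_
    have hx (q : Bool) : (Fin.append x (bit q) : BStr (0 + 1)) 0 = q := Fin.append_right x (bit q) 0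
    simp only [hx]
    cases p <;> simp
  convert (h (u true)).mul h' with x
  cases x 0 <;> simp

/-- The diagonal two-wire map with the given entries is generated. -/
def GenDiag₂ (k : Bool → Bool → ℂ) : Prop := GenDiag fun x : BStr 2 => k (x 0) (x 1)

lemma GenDiag₂.mul {k l : Bool → Bool → ℂ} (hk : GenDiag₂ k) (hl : GenDiag₂ l) :
    GenDiag₂ fun p q => k p q * l p q :=
  GenDiag.mul hk hl

lemma genDiag₂_prod (u v : Bool → ℂ) : GenDiag₂ fun p q => u p * v q :=
  (genDiag_bit u).tensVec (genDiag_bit v)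

lemma GenDiag₂.flip {k : Bool → Bool → ℂ} (hk : GenDiag₂ k) :
    GenDiag₂ fun p q => k p (!q) := by
  refine GenDiag.flip (n := 1) hk fun x q => ?_
  obtain ⟨p, rfl⟩ := exists_bit x
  rw [bit_append_bit, bit_append_bit]
  rfl

lemma genDiag₂_sign : GenDiag₂ fun p q => if p && q then -1 else 1 := by
  refine (Gen.fswap.comp Gen.swap).congr ?_
  ext b a
  obtain ⟨p, q, rfl⟩ := exists_two_bits b
  obtain ⟨r, s, rfl⟩ := exists_two_bits a
  simp only [Matrix.diagonal_apply, two_bits_inj, Matrix.mul_apply, sum_two_bits, sigmaM, FM]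
  cases p <;> cases q <;> cases r <;> cases s <;> simp

/-- Two diagonal gates sharing a wire that is summed over. -/
lemma GenDiag₂.star {k l : Bool → Bool → ℂ} (hk : GenDiag₂ k) (hl : GenDiag₂ l) :
    GenDiag₂ fun p q => ∑ r, k p r * l q r := by
  have h1 : GenDiag fun x : BStr (1 + 2) => l (x 1) (x 2) :=
    GenDiag.extend_left hl 1
  have h2 : GenDiag fun x : BStr (2 + 1) => k (x 0) (x 1) :=
    GenDiag.extend hk 1
  have h3 : GenDiag fun x : BStr (1 + 2) => k (x 0) (x 2) :=
    h2.swap (n := 1) fun x p q => congrArg₂ k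
      ((Fin.append_left x (bits p q) 0).trans (Fin.append_left x (bits q p) 0).symm)
      ((Fin.append_right x (bits p q) 1).trans (Fin.append_right x (bits q p) 0).symm)
  exact GenDiag.trace (n := 2) (h3.mul h1)

lemma genDiag₂_not_both : GenDiag₂ fun p q => if p && q then 0 else 1 := by
  have h4 : GenDiag₂ fun p q => if p && q then 4 else 1 := by
    convert (genDiag₂_prod (fun p => if p then 2 else 1) fun p => if p then 3 / 2 else 3 / 4).mul
      ((genDiag₂_sign.mul (genDiag₂_prod (fun _ => 1) fun r => if r then 1 / 3 else 1)).star
        genDiag₂_sign) using 3 with p q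
    cases p <;> cases q <;> norm_num
  convert (genDiag₂_prod (fun p => if p then 5 / 4 else 1)
      fun p => if p then 4 / 3 else 16 / 15).mul
    ((h4.mul (genDiag₂_prod (fun _ => 1) fun r => if r then -1 / 16 else 1)).star h4) using 3 with p q
  cases p <;> cases q <;> norm_num

lemma genDiag₂_control (α : Bool) : GenDiag₂ fun p q => if p && (q != α) then 0 else 1 := by
  cases α
  · simpa using genDiag₂_not_both
  · simpa using genDiag₂_not_both.flip

lemma genDiag_control {n : ℕ} (a : BStr n) : GenDiag fun x : BStr (n + 1) =>
    if x (Fin.natAdd n 0) = true ∧ (fun i => x (Fin.castAdd 1 i)) ≠ a then 0 else 1 := by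
  induction n with
  | zero =>
    convert genDiag_one 1 with x
    simp [eq_iff_true_of_subsingleton]
  | succ n ih =>
    obtain ⟨a, α, rfl⟩ := exists_append a
    obtain ⟨α, rfl⟩ := exists_bit α
    have h1 := (ih a).extend 1
    have h2 := GenDiag.extend_left (genDiag₂_control α) n
    refine (h1.mul h2).swap (n := n) fun x p q => ?_
    have e1 : Fin.append (m := n) (n := 2) x (bits p q) (Fin.natAdd (n + 1) (0 : Fin 1)) = q :=
      Fin.append_right x (bits p q) 1
    have e2 : (fun i : Fin (n + 1) =>
        Fin.append (m := n) (n := 2) x (bits p q) (Fin.castAdd 1 i)) = Fin.append x (bit p) := by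
      ext i
      rw [← append_append_bit]
      exact Fin.append_left (Fin.append x (bit p)) (bit q) i
    have e3 : (fun i : Fin (n + 1) =>
        Fin.append (m := n) (n := 2) x (bits q p) (Fin.castAdd 1 i)) = Fin.append x (bit q) := by
      ext i
      rw [← append_append_bit]
      exact Fin.append_left (Fin.append x (bit q)) (bit p) i
    rw [e1, e2, e3]
    simp only [Fin.append_left, Fin.append_right, bit_apply, bits_zero, bits_one, ne_eq,
      append_inj_iff, bit_inj]
    cases q <;> cases p <;> cases α <;> simp

lemma genDiag_ite {n : ℕ} (a : BStr n) (z : ℂ) : GenDiag fun x => if x = a then z else 1 := by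
  have h := ((genDiag_control a).mul
    ((genDiag_bit fun p => if p then z - 1 else 1).extend_left n)).trace
  convert h with x
  simp
  split_ifs <;> simp

lemma genDiag {n : ℕ} (f : BStr n → ℂ) : GenDiag f := by
  have h (s : Finset (BStr n)) : GenDiag fun x => ∏ a ∈ s, if x = a then f a else 1 := by
    induction s using Finset.induction_on with
    | empty => simpa using genDiag_one n
    | insert a s ha ih => simpa [Finset.prod_insert ha] using (genDiag_ite a (f a)).mul ih
  simpa using h Finset.univ

/-! ### Pure maps -/

/-- A map whose nonzero entries all have the same total parity. -/
def HasParity (e : Prop) {n m : ℕ} (A : QMap n m) : Prop :=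
  ∀ b a, A b a ≠ 0 → (Even (wt b + wt a) ↔ e)

lemma HasParity.gen {e : Prop} {n m : ℕ} {A : QMap n m} (hA : HasParity e A) : Gen A := by
  classical
  induction n generalizing m with
  | zero =>
    refine (Gen.comp (gen_parityS e m) (genDiag fun b => A b Fin.elim0)).congr ?_
    ext b a
    rw [Matrix.diagonal_mul, Subsingleton.elim a Fin.elim0]
    have := hA b Fin.elim0
    simp only [parityS, Matrix.of_apply, wt_zero, add_zero] at this ⊢
    split_ifs <;> simp_all
  | succ n ih =>
    let A' : QMap n (m + 1) := Matrix.of fun b a =>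
      A (fun i => b i.castSucc) (Fin.append a (bit (b (Fin.last m))))
    have hA' : HasParity e A' := by
      intro b a h
      obtain ⟨b, b', rfl⟩ := exists_append b
      obtain ⟨p, rfl⟩ := exists_bit b'
      have h3 := hA _ _ h
      have e1 : (fun i : Fin m => Fin.append b (bit p) i.castSucc) = b :=
        funext fun i => Fin.append_left b (bit p) i
      have e2 : Fin.append b (bit p) (Fin.last m) = p := Fin.append_right b (bit p) 0
      rw [e1, e2, wt_append] at h3
      rw [wt_append, ← h3]
      congr! 1
      ring
    refine (ih hA').bend.congr ?_
    ext b a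
    obtain ⟨a, a', rfl⟩ := exists_append a
    obtain ⟨p, rfl⟩ := exists_bit a'
    rw [bend_append]
    have e1 : (fun i : Fin m => Fin.append b (bit p) i.castSucc) = b :=
      funext fun i => Fin.append_left b (bit p) i
    have e2 : Fin.append b (bit p) (Fin.last m) = p := Fin.append_right b (bit p) 0
    simp only [A', Matrix.of_apply, e1, e2]

lemma evenSub_apply_eq_zero {n : ℕ} {v : Vec n} (hv : v ∈ evenSub n) {b : BStr n}
    (hb : ¬ Even (wt b)) : v b = 0 := by
  induction hv using Submodule.span_induction with
  | mem v hv =>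
    obtain ⟨a, ha, rfl⟩ := hv
    simp only [basisV, ite_eq_right_iff, one_ne_zero, imp_false]
    rintro rfl
    exact hb ha
  | zero => rfl
  | add v w _ _ hv hw => simp [hv, hw]
  | smul z v _ hv => simp [hv]

lemma oddSub_apply_eq_zero {n : ℕ} {v : Vec n} (hv : v ∈ oddSub n) {b : BStr n}
    (hb : Even (wt b)) : v b = 0 := by
  induction hv using Submodule.span_induction with
  | mem v hv =>
    obtain ⟨a, ha, rfl⟩ := hv
    simp only [basisV, ite_eq_right_iff, one_ne_zero, imp_false]
    rintro rfl
    exact Nat.not_even_iff_odd.2 ha hb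
  | zero => rfl
  | add v w _ _ hv hw => simp [hv, hw]
  | smul z v _ hv => simp [hv]

lemma mulVec_basisV {n m : ℕ} (A : QMap n m) (a : BStr n) (b : BStr m) :
    A.mulVec (basisV a) b = A b a := by
  simp [Matrix.mulVec, dotProduct, basisV]

lemma basisV_mem_evenSub {n : ℕ} {a : BStr n} (ha : Even (wt a)) : basisV a ∈ evenSub n :=
  Submodule.subset_span ⟨a, ha, rfl⟩

lemma basisV_mem_oddSub {n : ℕ} {a : BStr n} (ha : ¬ Even (wt a)) : basisV a ∈ oddSub n :=
  Submodule.subset_span ⟨a, Nat.not_even_iff_odd.1 ha, rfl⟩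

lemma IsEvenMap.hasParity {n m : ℕ} {A : QMap n m} (hA : IsEvenMap A) : HasParity True A := by
  intro b a h
  rw [← mulVec_basisV A a b] at h
  rw [Nat.even_add, iff_true]
  by_cases ha : Even (wt a)
  · exact iff_of_true (not_not.1 (mt (evenSub_apply_eq_zero (hA.1 _ (basisV_mem_evenSub ha))) h)) ha
  · exact iff_of_false (mt (oddSub_apply_eq_zero (hA.2 _ (basisV_mem_oddSub ha))) h) ha

lemma IsOddMap.hasParity {n m : ℕ} {A : QMap n m} (hA : IsOddMap A) : HasParity False A := by
  intro b a h
  rw [← mulVec_basisV A a b] at h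
  rw [Nat.even_add, iff_false]
  by_cases ha : Even (wt a)
  · exact fun hb => mt (oddSub_apply_eq_zero (hA.1 _ (basisV_mem_evenSub ha))) h (hb.2 ha)
  · exact fun hb => ha (hb.1 (not_not.1
      (mt (evenSub_apply_eq_zero (hA.2 _ (basisV_mem_oddSub ha))) h)))

/-- **Universality of the fermionic ZW calculus**: every pure linear map
`Q^{⊗n} → Q^{⊗m}` belongs to the family `𝒞`. -/
theorem fzw_universality {n m : ℕ} (A : QMap n m) (hA : IsPure A) : Gen A := by
  exact hA.elim (fun h => h.hasParity.gen) fun h => h.hasParity.gen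
end
end

section
/- Parity soundness of the fermionic ZW generators: every linear map belonging to the family 𝒞 is pure, i.e., it is either even or odd with respect to the parity grading of tensor powers of Q. -/
noncomputable section

/-- The nonzero entries of `A` all shift the parity of the weight by `d`. -/
def ShiftsParity {n m : ℕ} (d : ZMod 2) (A : QMap n m) : Prop :=
  ∀ b a, A b a ≠ 0 → (wt b : ZMod 2) = wt a + d

theorem wt_eq_sum {n : ℕ} (a : BStr n) : wt a = ∑ i, if a i = true then 1 else 0 := by
  simp [wt]

theorem wt_castAdd_add_wt_natAdd {n m : ℕ} (a : BStr (n + m)) :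
    wt (fun i => a (Fin.castAdd m i)) + wt (fun j => a (Fin.natAdd n j)) = wt a := by
  simp only [wt_eq_sum, Fin.sum_univ_add]

theorem mem_span_basisV {n : ℕ} {P : BStr n → Prop} {v : Vec n} (h : ∀ b, v b ≠ 0 → P b) :
    v ∈ Submodule.span ℂ {v | ∃ a : BStr n, P a ∧ v = basisV a} := by
  have hv : v = ∑ b, v b • basisV b := by
    ext c
    simp [basisV]
  rw [hv]
  refine Submodule.sum_mem _ fun b _ => ?_
  by_cases hb : v b = 0
  · simp [hb]
  · exact Submodule.smul_mem _ _ (Submodule.subset_span ⟨b, h b hb, rfl⟩)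

theorem mulVec_mem_span_basisV {n m : ℕ} {A : QMap n m} {P : BStr n → Prop}
    {R : BStr m → Prop} (h : ∀ b a, A b a ≠ 0 → P a → R b) {v : Vec n}
    (hv : v ∈ Submodule.span ℂ {v | ∃ a : BStr n, P a ∧ v = basisV a}) :
    A.mulVec v ∈ Submodule.span ℂ {v | ∃ a : BStr m, R a ∧ v = basisV a} := by
  induction hv using Submodule.span_induction with
  | mem v hv =>
    obtain ⟨a, ha, rfl⟩ := hv
    refine mem_span_basisV fun b hb => h b a ?_ ha
    simpa [Matrix.mulVec, dotProduct, basisV] using hb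
  | zero => simp
  | add v w _ _ hv hw =>
    rw [Matrix.mulVec_add]
    exact Submodule.add_mem _ hv hw
  | smul c v _ hv =>
    rw [Matrix.mulVec_smul]
    exact Submodule.smul_mem _ c hv

theorem ShiftsParity.isPure {n m : ℕ} {d : ZMod 2} {A : QMap n m} (h : ShiftsParity d A) :
    IsPure A := by
  have hd : ∀ e : ZMod 2, e = 0 ∨ e = 1 := by decide
  rcases hd d with rfl | rfl
  · refine Or.inl ⟨fun v => mulVec_mem_span_basisV fun b a hab ha => ?_,
      fun v => mulVec_mem_span_basisV fun b a hab ha => ?_⟩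
    · rw [← ZMod.natCast_eq_zero_iff_even] at ha ⊢
      rw [h b a hab, ha, add_zero]
    · rw [← ZMod.natCast_eq_one_iff_odd] at ha ⊢
      rw [h b a hab, ha, add_zero]
  · refine Or.inr ⟨fun v => mulVec_mem_span_basisV fun b a hab ha => ?_,
      fun v => mulVec_mem_span_basisV fun b a hab ha => ?_⟩
    · rw [← ZMod.natCast_eq_zero_iff_even] at ha
      rw [← ZMod.natCast_eq_one_iff_odd, h b a hab, ha, zero_add]
    · rw [← ZMod.natCast_eq_one_iff_odd] at ha
      rw [← ZMod.natCast_eq_zero_iff_even, h b a hab, ha]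
      rfl

theorem ShiftsParity.mul {n m k : ℕ} {d e : ZMod 2} {A : QMap n m} {B : QMap m k}
    (hA : ShiftsParity d A) (hB : ShiftsParity e B) : ShiftsParity (d + e) (B * A) := by
  intro b a hab
  rw [Matrix.mul_apply] at hab
  obtain ⟨c, -, hc⟩ := Finset.exists_ne_zero_of_sum_ne_zero hab
  rw [hB b c (left_ne_zero_of_mul hc), hA c a (right_ne_zero_of_mul hc), add_assoc]

theorem ShiftsParity.tensM {n m p q : ℕ} {d e : ZMod 2} {A : QMap n m} {B : QMap p q}
    (hA : ShiftsParity d A) (hB : ShiftsParity e B) :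
    ShiftsParity (d + e) (tensM A B) := by
  intro b a hab
  rw [← wt_castAdd_add_wt_natAdd b, ← wt_castAdd_add_wt_natAdd a, Nat.cast_add, Nat.cast_add,
    hA _ _ (left_ne_zero_of_mul hab), hB _ _ (right_ne_zero_of_mul hab)]
  ring

theorem wt_fin_zero (a : BStr 0) : wt a = 0 := by
  simp [wt_eq_sum]

theorem wt_fin_two (a : BStr 2) :
    wt a = (if a 0 = true then 1 else 0) + (if a 1 = true then 1 else 0) := by
  simp only [wt_eq_sum, Fin.sum_univ_two]

theorem Gen.exists_shiftsParity {n m : ℕ} {A : QMap n m} (hA : Gen A) :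
    ∃ d, ShiftsParity d A := by
  induction hA with
  | wire =>
    refine ⟨0, fun b a hab => ?_⟩
    rw [show b = a from by_contra fun h => hab (Matrix.one_apply_ne h), add_zero]
  | swap =>
    refine ⟨0, fun b a hab => ?_⟩
    have h : b 0 = a 1 ∧ b 1 = a 0 := by_contra fun h => hab (if_neg h)
    rw [wt_fin_two, wt_fin_two, h.1, h.2, add_comm, add_zero]
  | fswap =>
    refine ⟨0, fun b a hab => ?_⟩
    have h : b 0 = a 1 ∧ b 1 = a 0 := by_contra fun h => hab (if_neg h)
    rw [wt_fin_two, wt_fin_two, h.1, h.2, add_comm, add_zero]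
  | cup =>
    refine ⟨0, fun b a hab => ?_⟩
    have h : b 0 = b 1 := by_contra fun h => hab (if_neg h)
    rw [wt_fin_two, wt_fin_zero, h]
    cases b 1 <;> rfl
  | cap =>
    refine ⟨0, fun b a hab => ?_⟩
    have h : a 0 = a 1 := by_contra fun h => hab (if_neg h)
    rw [wt_fin_two, wt_fin_zero, h]
    cases a 1 <;> rfl
  | black2 =>
    refine ⟨1, fun b a hab => ?_⟩
    have h : b 0 ≠ b 1 := by_contra fun h => hab (if_neg h)
    rw [wt_fin_two, wt_fin_zero]
    revert h
    cases b 0 <;> cases b 1 <;> simp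
  | black3 =>
    refine ⟨1, fun b a hab => ?_⟩
    have h : wt b = 1 := by_contra fun h => hab (if_neg h)
    simp [h, wt_fin_zero]
  | white z =>
    refine ⟨0, fun b a hab => ?_⟩
    have h : b 0 = b 1 := by
      by_contra h
      revert h hab
      simp only [whiteS, Matrix.of_apply]
      cases b 0 <;> cases b 1 <;> simp
    rw [wt_fin_two, wt_fin_zero, h]
    cases b 1 <;> rfl
  | comp _ _ ihA ihB =>
    obtain ⟨d, hd⟩ := ihA
    obtain ⟨e, he⟩ := ihB
    exact ⟨d + e, hd.mul he⟩
  | prod _ _ ihA ihB =>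
    obtain ⟨d, hd⟩ := ihA
    obtain ⟨e, he⟩ := ihB
    exact ⟨d + e, hd.tensM he⟩

/-- **Parity soundness of the fermionic ZW generators**: every map in `𝒞` is pure. -/
theorem fzw_parity_soundness {n m : ℕ} (A : QMap n m) (hA : Gen A) : IsPure A :=
  hA.exists_shiftsParity.elim fun _ h => h.isPure
end
end

section
/- Closing a fermionic self-crossing yields the Pauli Z gate: (id_Q ⊗ c) ∘ (F ⊗ id_Q) ∘ (id_Q ⊗ η) = Z as linear maps Q → Q (equivalently, the partial closure of the fermionic swap equals the white vertex W_{−1}). -/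
noncomputable section

theorem sum_bstr_three (f : BStr 3 → ℂ) :
    ∑ x, f x = ∑ p, ∑ q, ∑ r, f ![p, q, r] := by
  rw [← (Fin.consEquiv fun _ : Fin 3 => Bool).sum_comp, Fintype.sum_prod_type]
  refine Finset.sum_congr rfl fun p _ => ?_
  rw [← (Fin.consEquiv fun _ : Fin 2 => Bool).sum_comp, Fintype.sum_prod_type]
  refine Finset.sum_congr rfl fun q _ => ?_
  rw [← (Equiv.funUnique (Fin 1) Bool).symm.sum_comp]
  refine Finset.sum_congr rfl fun r _ => congrArg f ?_
  ext i
  fin_cases i <;> rfl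

theorem bstr_one_eq_const (a : BStr 1) : ∃ p, a = fun _ => p :=
  ⟨a 0, funext fun i => congrArg a (Subsingleton.elim i 0)⟩

theorem const_bstr_one_eq_iff (p q : Bool) :
    ((fun _ => p : BStr 1) = fun _ => q) ↔ p = q :=
  ⟨fun h => congrFun h 0, fun h => h ▸ rfl⟩

theorem tensM_idQ_capM_apply (b : Bool) (x : BStr 3) :
    (tensM idQ capM : QMap 3 1) (fun _ => b) x =
      (if b = x 0 then 1 else 0) * if x 1 = x 2 then 1 else 0 := by
  change (1 : QMap 1 1) (fun _ => b) _ * _ = _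
  obtain ⟨p, hp⟩ := bstr_one_eq_const fun i => x (Fin.castAdd 2 i)
  have h : x 0 = p := congrFun hp 0
  rw [hp, Matrix.one_apply, h]
  simp only [const_bstr_one_eq_iff]
  rfl

theorem tensM_FM_idQ_apply (x y : BStr 3) :
    (tensM FM idQ : QMap 3 3) x y =
      (if x 0 = y 1 ∧ x 1 = y 0 then (if y 0 && y 1 then -1 else 1) else 0) *
        if x 2 = y 2 then 1 else 0 := by
  change _ * (1 : QMap 1 1) (fun j => x (Fin.natAdd 2 j)) (fun j => y (Fin.natAdd 2 j)) = _
  obtain ⟨p, hp⟩ := bstr_one_eq_const fun j => x (Fin.natAdd 2 j)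
  obtain ⟨q, hq⟩ := bstr_one_eq_const fun j => y (Fin.natAdd 2 j)
  have hx : x 2 = p := congrFun hp 0
  have hy : y 2 = q := congrFun hq 0
  rw [hp, hq, Matrix.one_apply, hx, hy]
  simp only [const_bstr_one_eq_iff]
  rfl

theorem tensM_idQ_cupM_apply (y : BStr 3) (a : Bool) :
    (tensM idQ cupM : QMap 1 3) y (fun _ => a) =
      (if y 0 = a then 1 else 0) * if y 1 = y 2 then 1 else 0 := by
  change (1 : QMap 1 1) _ (fun _ => a) * _ = _
  obtain ⟨p, hp⟩ := bstr_one_eq_const fun i => y (Fin.castAdd 2 i)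
  have h : y 0 = p := congrFun hp 0
  rw [hp, Matrix.one_apply, h]
  simp only [const_bstr_one_eq_iff]
  rfl

/-- **Closing a fermionic self-crossing yields the Pauli `Z` gate**, i.e. the white
vertex `W_{−1}`. -/
theorem closed_self_crossing_is_Z :
    tensM idQ capM * tensM FM idQ * tensM idQ cupM = Zm ∧ Zm = Wmap (-1) := by
  refine ⟨?_, rfl⟩
  ext b a
  obtain ⟨b, rfl⟩ := bstr_one_eq_const b
  obtain ⟨a, rfl⟩ := bstr_one_eq_const a
  change ∑ y : BStr 3, (∑ x : BStr 3, (tensM idQ capM : QMap 3 1) (fun _ => b) x *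
    (tensM FM idQ : QMap 3 3) x y) * (tensM idQ cupM : QMap 1 3) y (fun _ => a) = _
  simp only [tensM_idQ_capM_apply, tensM_FM_idQ_apply, tensM_idQ_cupM_apply, sum_bstr_three,
    Zm, Matrix.of_apply, const_bstr_one_eq_iff]
  cases a <;> cases b <;> simp
end
end

section
/- White spider fusion: for all p, q, r, s ∈ ℕ and z, w ∈ ℂ, connecting one leg of a white spider with parameter z to one leg of a white spider with parameter w merges them into a single white spider with parameter zw; precisely, (id_{Q^{⊗q}} ⊗ V^w_{r+1,s}) ∘ (V^z_{p,q+1} ⊗ id_{Q^{⊗r}}) = V^{zw}_{p+r, q+s} as linear maps Q^{⊗(p+r)} → Q^{⊗(q+s)}. -/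
noncomputable section

/-- Splitting the universal quantifier over `n + m` wires along a tensor factorisation. -/
theorem forall_fin_add {n m : ℕ} {P : Fin (n + m) → Prop} :
    (∀ i, P i) ↔ (∀ i, P (Fin.castAdd m i)) ∧ ∀ j, P (Fin.natAdd n j) :=
  ⟨fun h => ⟨fun _ => h _, fun _ => h _⟩, fun h i => Fin.addCases h.1 h.2 i⟩

/-- The bitstring with bits `u`, then `x`, then `v`. -/
def joinStr {q r : ℕ} (u : BStr q) (v : BStr r) (x : Bool) : BStr (q + (r + 1)) :=
  Fin.append u (Fin.cons x v : Fin (r + 1) → Bool)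

theorem joinStr_injective {q r : ℕ} (u : BStr q) (v : BStr r) :
    Function.Injective (joinStr u v) := fun x y h => by
  simpa [joinStr] using congrFun h (Fin.natAdd q 0)

theorem cast_castAdd_castSucc (q r : ℕ) (h : q + (r + 1) = (q + 1) + r) (i : Fin q) :
    Fin.cast h.symm (Fin.castAdd r i.castSucc) = Fin.castAdd (r + 1) i := rfl

theorem cast_castAdd_last (q r : ℕ) (h : q + (r + 1) = (q + 1) + r) :
    Fin.cast h.symm (Fin.castAdd r (Fin.last q)) = Fin.natAdd q (0 : Fin (r + 1)) := rfl

theorem cast_natAdd_succ (q r : ℕ) (h : q + (r + 1) = (q + 1) + r) (j : Fin r) :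
    Fin.cast h.symm (Fin.natAdd (q + 1) j) = Fin.natAdd q j.succ := by
  ext
  simp
  omega

theorem eq_joinStr {q r : ℕ} (c : BStr (q + (r + 1))) :
    c = joinStr (fun i => c (Fin.castAdd (r + 1) i)) (fun j => c (Fin.natAdd q j.succ))
      (c (Fin.natAdd q 0)) := by
  funext i
  refine Fin.addCases (fun i => ?_) (fun j => ?_) i
  · simp [joinStr]
  · refine Fin.cases ?_ (fun j => ?_) j <;> simp [joinStr]

/-- **White spider fusion**: connecting one leg of a white spider with parameter `z`
to one leg of a white spider with parameter `w` merges them into a single white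
spider with parameter `z·w`. -/
theorem white_spider_fusion (p q r s : ℕ) (z w : ℂ) :
    tensM (idN q) (wspider w (r + 1) s) *
      castM rfl (by omega : (q + 1) + r = q + (r + 1))
        (tensM (wspider z p (q + 1)) (idN r)) =
    wspider (z * w) (p + r) (q + s) := by
  ext b a
  have hq : (q + 1) + r = q + (r + 1) := by omega
  rw [Matrix.mul_apply, ← Fintype.sum_of_injective
    (joinStr (fun i => b (Fin.castAdd s i)) (fun j => a (Fin.natAdd p j)))
    (joinStr_injective _ _) _ _ ?_ fun _ => rfl]
  · simp only [Fintype.sum_bool, tensM, castM, wspider, idN, Matrix.of_apply, Matrix.one_apply,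
      @Fin.forall_fin_succ r, @Fin.forall_fin_succ' q, @forall_fin_add p r, @forall_fin_add q s,
      Fin.cast_eq_self,
      cast_castAdd_castSucc q r hq.symm, cast_castAdd_last q r hq.symm,
      cast_natAdd_succ q r hq.symm, joinStr, Fin.append_left, Fin.append_right,
      Fin.cons_zero, Fin.cons_succ]
    simp only [← ite_and, if_true, one_mul, mul_one, Bool.true_eq_false, Bool.false_eq_true,
      false_and, and_false, and_true, true_and, if_false, zero_add, add_zero, mul_ite, ite_mul,
      mul_zero, zero_mul]
    rw [add_comm]
    congr 1
    · congr 1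
      exact propext (by tauto)
    · rw [mul_comm w z]
      congr 1
      exact propext (by tauto)
  · intro c hc
    simp only [tensM, castM, idN, Matrix.of_apply, Matrix.one_apply, Fin.cast_eq_self,
      cast_natAdd_succ q r hq.symm]
    by_contra h
    simp only [mul_eq_zero, ite_eq_right_iff, one_ne_zero, imp_false, not_or, not_not] at h
    exact hc ⟨c (Fin.natAdd q 0), by rw [h.1.1, ← h.2.2]; exact (eq_joinStr c).symm⟩
end
end

section
/- Convolution (sum) law for white vertices along black spiders: for all p, q, n ∈ ℕ and all z : Fin n → ℂ, B_{n,q} ∘ (W_{z₁} ⊗ W_{z₂} ⊗ ⋯ ⊗ W_{zₙ}) ∘ B_{p,n} = B_{1,q} ∘ W_{z₁+z₂+⋯+zₙ} ∘ B_{p,1} as linear maps Q^{⊗p} → Q^{⊗q}; that is, n parallel white vertices with parameters z₁,…,zₙ joining two black spiders equal a single white vertex with parameter Σᵢ zᵢ joining them. -/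
noncomputable section

theorem wt_eq_zero_iff {n : ℕ} {c : BStr n} : wt c = 0 ↔ c = fun _ => false := by
  simp [wt, Finset.filter_eq_empty_iff, funext_iff]

theorem wt_eq_one_iff {n : ℕ} {c : BStr n} : wt c = 1 ↔ ∃ k, deltaStr k = c := by
  simp only [wt, Finset.card_eq_one, Finset.ext_iff, funext_iff, deltaStr, Finset.mem_filter,
    Finset.mem_univ, true_and, Finset.mem_singleton]
  refine exists_congr fun k => forall_congr' fun i => ?_
  by_cases h : i = k <;> cases c i <;> simp [h]

theorem deltaStr_injective (n : ℕ) : Function.Injective (deltaStr (n := n)) := by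
  intro k l h
  simpa [deltaStr] using congrFun h k

theorem whites_eq_diagonal {n : ℕ} (z : Fin n → ℂ) :
    whites z = Matrix.diagonal fun c : BStr n => ∏ i, if c i then z i else 1 := by
  ext b a
  rw [whites, Matrix.of_apply, Matrix.diagonal_apply]
  split_ifs with h
  · simp [h, Wentry]
  · obtain ⟨i, hi⟩ := Function.ne_iff.mp h
    exact Finset.prod_eq_zero (Finset.mem_univ i) (if_neg hi)

theorem Wmap_eq_whites (z : ℂ) : Wmap z = whites fun _ : Fin 1 => z := by
  rw [whites_eq_diagonal]
  ext b a
  simp only [Wmap, Matrix.of_apply, Matrix.diagonal_apply, Fin.prod_univ_one]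
  split_ifs <;> simp_all

theorem sum_wt_eq_zero {n : ℕ} (z : Fin n → ℂ) :
    (∑ c : BStr n with wt c = 0, ∏ i, if c i then z i else 1) = 1 := by
  simp [wt_eq_zero_iff, Finset.filter_eq']

theorem sum_wt_eq_one {n : ℕ} (z : Fin n → ℂ) :
    (∑ c : BStr n with wt c = 1, ∏ i, if c i then z i else 1) = ∑ i, z i := by
  have h : (Finset.univ.filter fun c : BStr n => wt c = 1) = Finset.univ.image deltaStr := by
    ext c
    simp [wt_eq_one_iff]
  rw [h, Finset.sum_image (deltaStr_injective n).injOn]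
  simp [deltaStr]

/-- The entries of `B_{n,q} ∘ (W_{z₁} ⊗ ⋯ ⊗ W_{zₙ}) ∘ B_{p,n}`. -/
theorem bspider_mul_whites_mul_bspider_apply {p q n : ℕ} (z : Fin n → ℂ)
    (b : BStr q) (a : BStr p) :
    (bspider n q * whites z * bspider p n) b a =
      if wt b = 1 ∧ wt a = 1 then 1 else if wt b = 0 ∧ wt a = 0 then ∑ i, z i else 0 := by
  rw [whites_eq_diagonal, Matrix.mul_apply]
  simp only [Matrix.mul_diagonal, bspider, Matrix.of_apply]
  split_ifs with h₁ h₀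
  · refine Eq.trans ?_ (sum_wt_eq_zero z)
    rw [Finset.sum_filter]
    refine Finset.sum_congr rfl fun c _ => ?_
    simp +contextual [h₁.1, h₁.2]
  · rw [← sum_wt_eq_one z, Finset.sum_filter]
    refine Finset.sum_congr rfl fun c _ => ?_
    simp +contextual [h₀.1, h₀.2]
  · refine Finset.sum_eq_zero fun c _ => ?_
    split_ifs <;> first | omega | simp

/-- **Convolution (sum) law for white vertices along black spiders**: `n` parallel
white vertices with parameters `z₁,…,zₙ` joining two black spiders equal a single
white vertex with parameter `Σᵢ zᵢ` joining them. -/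
theorem white_convolution_on_black_spiders (p q n : ℕ) (z : Fin n → ℂ) :
    bspider n q * whites z * bspider p n =
      bspider 1 q * Wmap (∑ i, z i) * bspider p 1 := by
  ext b a
  simp only [Wmap_eq_whites, bspider_mul_whites_mul_bspider_apply, Fin.sum_univ_one]
end
end
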